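/- Let G be a connected groupoid, let x be an object of G, and let M be a subgroup of the vertex group G(x). Then there exist a connected groupoid G̃, a covering morphism of groupoids p : G̃ ⥤ G, and an object x̃ of G̃ with p(x̃) = x such that the image of the vertex group G̃(x̃) under p equals M. -/

import Mathlib

open CategoryTheory

universe u v

/-- The map induced by a functor `p` from the costar of `y` (all morphisms with target `y`)
to the costar of `p.obj y`. -/
def costarMap {H : Type*} {G : Type*} [Groupoid H] [Groupoid G] (p : H ⥤ G) (y : H) :
    (Σ u : H, u ⟶ y) → Σ v : G, v ⟶ p.obj y :=
  fun z => ⟨p.obj z.1, p.map z.2⟩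

/-- A morphism of groupoids is a covering morphism if it induces a bijection on all costars. -/
def IsCoveringMorphism {H : Type*} {G : Type*} [Groupoid H] [Groupoid G] (p : H ⥤ G) : Prop :=
  ∀ y : H, Function.Bijective (costarMap p y)

/-- A groupoid is connected if there is a morphism between any two of its objects. -/
def GroupoidConnected (F : Type*) [Groupoid F] : Prop :=
  ∀ x y : F, Nonempty (x ⟶ y)

/-- The groupoid structure on a groupoid whose morphisms have been lifted to a higher universe. -/
instance ULiftHom.groupoid {C : Type*} [Groupoid C] : Groupoid (ULiftHom C) where
  inv f := ⟨Groupoid.inv f.down⟩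
  inv_comp f := ULift.ext _ _ (Groupoid.inv_comp f.down)
  comp_inv f := ULift.ext _ _ (Groupoid.comp_inv f.down)

theorem isCoveringMorphism_uliftHomDown {C : Type*} [Groupoid C] :
    IsCoveringMorphism (ULiftHom.down : ULiftHom C ⥤ C) := fun _ =>
  ⟨by rintro ⟨a, ⟨f⟩⟩ ⟨b, ⟨g⟩⟩ h; cases h; rfl, fun ⟨a, f⟩ => ⟨⟨ULiftHom.objUp a, ⟨f⟩⟩, rfl⟩⟩

theorem IsCoveringMorphism.comp {K H G : Type*} [Groupoid K] [Groupoid H] [Groupoid G]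
    {q : K ⥤ H} {p : H ⥤ G} (hp : IsCoveringMorphism p) (hq : IsCoveringMorphism q) :
    IsCoveringMorphism (q ⋙ p) := fun y =>
  (hp (q.obj y)).comp (hq y)

/-- The projection from the groupoid of elements of a set-valued functor is a covering morphism. -/
theorem isCoveringMorphism_elements {G : Type*} [Groupoid G] (F : G ⥤ Type*) :
    IsCoveringMorphism (CategoryOfElements.π F) := by
  intro y
  constructor
  · rintro ⟨⟨a, s⟩, f, hf⟩ ⟨⟨b, t⟩, g, hg⟩ h
    obtain ⟨rfl, h⟩ := Sigma.mk.inj h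
    obtain rfl : f = g := eq_of_heq h
    obtain rfl : s = t := by
      have : Function.Injective (F.map f) := ((isIso_iff_bijective _).1 inferInstance).1
      exact this (hf.trans hg.symm)
    rfl
  · rintro ⟨v, f : v ⟶ y.1⟩
    refine ⟨⟨⟨v, F.map (inv f) y.2⟩, f, ?_⟩, rfl⟩
    simp

section RightCosets

variable {G : Type u} [Groupoid.{v} G] {x : G} (M : Subgroup (x ⟶ x))

/-- Two morphisms out of `x` are related when they differ by precomposition with an element of
`M`. -/
def rightCosetSetoid (y : G) : Setoid (x ⟶ y) where
  r f g := f ≫ inv g ∈ M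
  iseqv :=
    { refl := fun f => by simpa using M.one_mem
      symm := fun {f g} h => by simpa [Groupoid.vertexGroup.inv_eq_inv] using M.inv_mem h
      trans := fun {f g k} h h' => by simpa using M.mul_mem h h' }

/-- The functor sending `y` to the right cosets of `M` in the morphisms `x ⟶ y`. -/
def rightCosetFunctor : G ⥤ Type v where
  obj y := Quotient (rightCosetSetoid M y)
  map h := ↾(Quotient.map (· ≫ h) fun f g hfg => by
    have : f ≫ inv g ∈ M := hfg
    change (f ≫ h) ≫ inv (g ≫ h) ∈ M
    simpa using this)
  map_id y := by
    ext a
    induction a using Quotient.inductionOn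
    simp
  map_comp h k := by
    ext a
    induction a using Quotient.inductionOn
    simp

/-- The right coset of a morphism, as an object of the groupoid of elements. -/
def rightCoset {y : G} (f : x ⟶ y) : (rightCosetFunctor M).Elements :=
  ⟨y, Quotient.mk (rightCosetSetoid M y) f⟩

theorem rightCosetFunctor_map_eq_iff {y z : G} (f : x ⟶ y) (h : y ⟶ z) (g : x ⟶ z) :
    (rightCosetFunctor M).map h (rightCoset M f).2 = (rightCoset M g).2 ↔
      (f ≫ h) ≫ inv g ∈ M :=
  Quotient.eq (r := rightCosetSetoid M z) (x := f ≫ h) (y := g)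

theorem groupoidConnected_rightCosetFunctor_elements :
    GroupoidConnected (rightCosetFunctor M).Elements := by
  rintro ⟨y, a⟩ ⟨z, b⟩
  induction a using Quotient.inductionOn with | _ f
  induction b using Quotient.inductionOn with | _ g
  refine ⟨⟨inv f ≫ g, (rightCosetFunctor_map_eq_iff M f _ g).2 ?_⟩⟩
  simpa using M.one_mem

end RightCosets

/-- every subgroup `M` of a vertex group of a connected groupoid `G` determines
a connected covering morphism `p : G' ⥤ G` with a base point `x'` over `x` whose characteristic
subgroup (the image of the vertex group at `x'` under `p`) is exactly `M`. -/
theorem exists_covering_of_subgroup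
    {G : Type u} [Groupoid.{v} G] (hG : GroupoidConnected G) (x : G)
    (M : Subgroup (x ⟶ x)) :
    ∃ (G' : Type (max u v)) (_ : Groupoid.{max u v} G') (p : G' ⥤ G) (x' : G')
      (hx' : p.obj x' = x),
      IsCoveringMorphism p ∧ GroupoidConnected G' ∧
      {g : x ⟶ x | ∃ b : x' ⟶ x', eqToHom hx'.symm ≫ p.map b ≫ eqToHom hx' = g} =
        (M : Set (x ⟶ x)) := by
  refine ⟨ULiftHom.{max u v} (rightCosetFunctor M).Elements, inferInstance,
    ULiftHom.down ⋙ CategoryOfElements.π _, ULiftHom.objUp (rightCoset M (𝟙 x)), rfl,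
    (isCoveringMorphism_elements _).comp isCoveringMorphism_uliftHomDown,
    fun a b => (groupoidConnected_rightCosetFunctor_elements M a.objDown b.objDown).map ULift.up,
    ?_⟩
  ext g
  have key := rightCosetFunctor_map_eq_iff M (𝟙 x) g (𝟙 x)
  rw [Category.id_comp, IsIso.inv_id, Category.comp_id] at key
  refine Iff.trans ?_ key
  have conj_refl (h : x ⟶ x) : 𝟙 x ≫ h ≫ 𝟙 x = h := by simp
  constructor
  · rintro ⟨⟨h, hh⟩, rfl⟩
    exact (congrArg (fun k => (rightCosetFunctor M).map k (rightCoset M (𝟙 x)).2)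
      (conj_refl h)).trans hh
  · exact fun hg => ⟨⟨⟨g, hg⟩⟩, conj_refl g⟩
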